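/- If x ∈ [0,1] is continued fraction normal, then for every integer k ≥ 2 and b ≥ 1, the number whose continued fraction partial quotients are x_b, x_{b+k}, x_{b+2k}, … is not continued fraction normal. -/

import Mathlib

open MeasureTheory Filter

noncomputable def gaussMap (x : ℝ) : ℝ := Int.fract x⁻¹

noncomputable def gaussMeasure : Measure ℝ :=
  (volume.restrict (Set.Ioo (0:ℝ) 1)).withDensity
    (fun x => ENNReal.ofReal (1 / ((1 + x) * Real.log 2)))

noncomputable def cfDigit (x : ℝ) (i : ℕ) : ℕ := ⌊(gaussMap^[i] x)⁻¹⌋₊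

def cylinder (w : List ℕ) : Set ℝ :=
  {x | x ∈ Set.Ioo (0:ℝ) 1 ∧ ∀ i < w.length, cfDigit x i = w.getD i 0}

noncomputable def blockCount (x : ℝ) (m : ℕ) (s : List ℕ) (N : ℕ) : ℕ :=
  Nat.card {i : ℕ // i ≤ N ∧ (gaussMap^[m * i] x) ∈ cylinder s}

def CFNormal (x : ℝ) : Prop :=
  ∀ s : List ℕ, s ≠ [] → (∀ a ∈ s, 0 < a) →
    Tendsto (fun n : ℕ => (blockCount x 1 s n : ℝ) / n) atTop
      (nhds (gaussMeasure (cylinder s)).toReal)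

def cfVal : List ℕ → ℚ
  | [] => 0
  | a :: t => 1 / (a + cfVal t)

def cfQ (a : ℕ → ℕ) : ℕ → ℕ
  | 0 => 0
  | 1 => 1
  | (m+2) => a (m+1) * cfQ a (m+1) + cfQ a m

def cfP (a : ℕ → ℕ) : ℕ → ℕ
  | 0 => 1
  | 1 => 0
  | (m+2) => a (m+1) * cfP a (m+1) + cfP a m

open Set

lemma measurable_gaussMap : Measurable gaussMap :=
  measurable_fract.comp measurable_inv

lemma cfDigit_iterate (z : ℝ) (i j : ℕ) : cfDigit (gaussMap^[j] z) i = cfDigit z (j + i) := by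
  rw [cfDigit, cfDigit, ← Function.iterate_add_apply, Nat.add_comm]

lemma measurableSet_cfDigit_eq (m : ℕ) : MeasurableSet {z : ℝ | cfDigit z 0 = m} :=
  (Nat.measurable_floor.comp measurable_inv) (measurableSet_singleton m)

/-- The reals whose digits at the places `0, k, 2k, …` spell the word `v`. -/
def sampledCylinder (k : ℕ) (v : List ℕ) : Set ℝ :=
  {z | ∀ i < v.length, cfDigit z (i * k) = v.getD i 0}

lemma sampledCylinder_cons (k a : ℕ) (v : List ℕ) :
    sampledCylinder k (a :: v) =
      {z | cfDigit z 0 = a} ∩ gaussMap^[k] ⁻¹' sampledCylinder k v := by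
  ext z
  simp only [sampledCylinder, mem_ofPred_eq, mem_inter_iff, mem_preimage, cfDigit_iterate,
    List.length_cons]
  constructor
  · intro h
    refine ⟨by simpa using h 0 (by omega), fun i hi => ?_⟩
    have := h (i + 1) (by omega)
    rw [List.getD_cons_succ] at this
    rw [← this]; congr 1; ring
  · rintro ⟨h0, h⟩ i hi
    cases i with
    | zero => simpa using h0
    | succ i =>
      rw [List.getD_cons_succ, ← h i (by omega)]; congr 1; ring

lemma cylinder_eq (v : List ℕ) : cylinder v = Ioo 0 1 ∩ sampledCylinder 1 v := by
  ext z; simp [_root_.cylinder, sampledCylinder]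

lemma measurableSet_sampledCylinder (k : ℕ) (v : List ℕ) :
    MeasurableSet (sampledCylinder k v) := by
  induction v with
  | nil => simp [sampledCylinder]
  | cons a v ih =>
    rw [sampledCylinder_cons]
    exact (measurableSet_cfDigit_eq a).inter (measurable_gaussMap.iterate k ih)

/-- The mass of `A ∩ (0, 1)` for the density `g`. -/
noncomputable def mass (g : ℝ → ℝ) (A : Set ℝ) : ENNReal :=
  ∫⁻ x in Ioo (0:ℝ) 1 ∩ A, ENNReal.ofReal (g x)

lemma mass_mono {g h : ℝ → ℝ} {A : Set ℝ} (hA : MeasurableSet A)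
    (H : ∀ x ∈ Ioo (0:ℝ) 1, x ∈ A → g x ≤ h x) : mass g A ≤ mass h A :=
  setLIntegral_mono' (measurableSet_Ioo.inter hA)
    fun x hx => ENNReal.ofReal_le_ofReal (H x hx.1 hx.2)

lemma mass_const_mul {c : ℝ} (hc : 0 ≤ c) (g : ℝ → ℝ) (A : Set ℝ) :
    mass (fun x => c * g x) A = ENNReal.ofReal c * mass g A := by
  simp only [mass, ENNReal.ofReal_mul hc]
  exact lintegral_const_mul' _ _ ENNReal.ofReal_ne_top

lemma cfDigit_zero_inv_add {m : ℕ} {y : ℝ} (hy : y ∈ Ioo (0:ℝ) 1) :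
    cfDigit (m + y)⁻¹ 0 = m := by
  simp only [cfDigit, Function.iterate_zero, id_eq, inv_inv]
  rw [Nat.floor_eq_iff (by have := hy.1; positivity)]
  constructor <;> linarith [hy.1, hy.2]

lemma gaussMap_inv_add {m : ℕ} {y : ℝ} (hy : y ∈ Ioo (0:ℝ) 1) :
    gaussMap (m + y)⁻¹ = y := by
  rw [gaussMap, inv_inv, Int.fract_natCast_add]
  exact Int.fract_eq_self.2 ⟨hy.1.le, hy.2⟩

lemma natCast_add_gaussMap {z : ℝ} (hz : 0 < z) :
    (cfDigit z 0 : ℝ) + gaussMap z = z⁻¹ := by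
  have : ((⌊z⁻¹⌋₊ : ℕ) : ℝ) = ((⌊z⁻¹⌋ : ℤ) : ℝ) := natCast_floor_eq_intCast_floor (by positivity)
  simp only [cfDigit, gaussMap, Function.iterate_zero, id_eq]
  rw [this, Int.floor_add_fract]

/-- Change of variables along the branch of the Gauss map with digit `m`. -/
lemma mass_branch (g : ℝ → ℝ) {m : ℕ} (hm : 1 ≤ m) {A : Set ℝ} (hA : MeasurableSet A) :
    mass g ({z | cfDigit z 0 = m} ∩ gaussMap ⁻¹' A) =
      mass (fun y => ((m + y) ^ 2)⁻¹ * g (m + y)⁻¹) A := by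
  have hm' : (1:ℝ) ≤ m := by exact_mod_cast hm
  have hset : (Ioo (0:ℝ) 1 ∩ ({z | cfDigit z 0 = m} ∩ gaussMap ⁻¹' A) : Set ℝ) =ᵐ[volume]
      ((fun y : ℝ => (m + y)⁻¹) '' (Ioo (0:ℝ) 1 ∩ A) : Set ℝ) := by
    have hnull : ∀ᵐ z : ℝ, z ≠ (m : ℝ)⁻¹ := by
      simp [ae_iff]
    filter_upwards [hnull] with z hz
    refine propext ⟨?_, ?_⟩
    · rintro ⟨h01, hd, hT⟩
      have h := natCast_add_gaussMap h01.1
      rw [show cfDigit z 0 = m from hd] at h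
      have hT0 : gaussMap z ≠ 0 := by
        intro h0
        rw [h0, add_zero] at h
        exact hz (by rw [h, inv_inv])
      refine ⟨gaussMap z, ⟨⟨lt_of_le_of_ne (Int.fract_nonneg _) hT0.symm, Int.fract_lt_one _⟩,
        hT⟩, ?_⟩
      simp only [h, inv_inv]
    · rintro ⟨y, ⟨hy, hyA⟩, rfl⟩
      refine ⟨⟨by have := hy.1; positivity, inv_lt_one_of_one_lt₀ (by linarith [hy.1])⟩,
        cfDigit_zero_inv_add hy, ?_⟩
      simpa only [mem_preimage, gaussMap_inv_add hy] using hyA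
  rw [mass, mass, setLIntegral_congr hset,
    lintegral_image_eq_lintegral_abs_deriv_mul (f' := fun y : ℝ => -1 / (m + y) ^ 2)
      (measurableSet_Ioo.inter hA)]
  · refine setLIntegral_congr_fun (measurableSet_Ioo.inter hA) fun y hy => ?_
    have : 0 < (m:ℝ) + y := by linarith [hy.1.1]
    rw [ENNReal.ofReal_mul (by positivity), abs_div, abs_neg, abs_one, abs_of_pos (by positivity),
      one_div]
  · intro y hy
    have h0 : (m:ℝ) + y ≠ 0 := by linarith [hy.1.1]
    exact (((hasDerivAt_id y).const_add (m:ℝ)).fun_inv h0).hasDerivWithinAt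
  · intro y _ z _ h
    simpa using h

lemma mass_preimage_le {g H : ℝ → ℝ} (hg : Measurable g) (hg0 : ∀ z, 0 < z → 0 ≤ g z)
    (hgH : ∀ y ∈ Ioo (0:ℝ) 1, ∀ M : ℕ,
      ∑ m ∈ Finset.range M, (((m + 1 : ℕ) + y) ^ 2)⁻¹ * g ((m + 1 : ℕ) + y)⁻¹ ≤ H y)
    {A : Set ℝ} (hA : MeasurableSet A) :
    mass g (gaussMap ⁻¹' A) ≤ mass H A := by
  have hcover : Ioo (0:ℝ) 1 ∩ gaussMap ⁻¹' A ⊆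
      ⋃ m : ℕ, Ioo (0:ℝ) 1 ∩ ({z | cfDigit z 0 = m + 1} ∩ gaussMap ⁻¹' A) := by
    rintro z ⟨hz, hzA⟩
    have : 1 ≤ cfDigit z 0 := by
      simp only [cfDigit, Function.iterate_zero, id_eq]
      exact (Nat.one_le_floor_iff _).2 (one_le_inv₀ hz.1 |>.2 hz.2.le)
    exact mem_iUnion.2 ⟨cfDigit z 0 - 1, hz, by simp only [mem_ofPred_eq]; omega, hzA⟩
  calc mass g (gaussMap ⁻¹' A)
      ≤ ∑' m : ℕ, mass g ({z | cfDigit z 0 = m + 1} ∩ gaussMap ⁻¹' A) :=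
        (lintegral_mono_set hcover).trans (lintegral_iUnion_le _ _)
    _ ≤ mass H A := by
        refine ENNReal.tsum_le_of_sum_range_le fun M => ?_
        rw [Finset.sum_congr rfl fun m _ => mass_branch g (m := m + 1) (by omega) hA]
        simp only [mass]
        rw [← lintegral_finsetSum _ fun m _ => by fun_prop]
        refine setLIntegral_mono' (measurableSet_Ioo.inter hA) fun y hy => ?_
        rw [← ENNReal.ofReal_sum_of_nonneg fun m _ => mul_nonneg (by positivity)
          (hg0 _ (by have := hy.1.1; positivity))]
        exact ENNReal.ofReal_le_ofReal (hgH y hy.1 M)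

lemma sum_le_of_telescope {t F : ℝ → ℝ} (hF : ∀ u, 0 < u → 0 ≤ F u)
    (h : ∀ u, 0 < u → t u ≤ F u - F (u + 1)) {y : ℝ} (hy : 0 < y) (M : ℕ) :
    ∑ m ∈ Finset.range M, t ((m + 1 : ℕ) + y) ≤ F (1 + y) := by
  have key : ∑ m ∈ Finset.range M, t ((m + 1 : ℕ) + y) ≤ F (1 + y) - F (M + 1 + y) := by
    induction M with
    | zero => simp
    | succ M ih =>
      rw [Finset.sum_range_succ]
      have := h ((M + 1 : ℕ) + y) (by positivity)
      push_cast at this ih ⊢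
      rw [show (M:ℝ) + 1 + y + 1 = M + 1 + 1 + y by ring] at this
      linarith
  have := hF (M + 1 + y) (by positivity)
  linarith

lemma mass_gauss_preimage_le {A : Set ℝ} (hA : MeasurableSet A) :
    mass (fun x => (1 + x)⁻¹) (gaussMap ⁻¹' A) ≤ mass (fun x => (1 + x)⁻¹) A := by
  refine mass_preimage_le (by fun_prop) (fun z hz => by positivity) (fun y hy M => ?_) hA
  refine sum_le_of_telescope (t := fun u => (u ^ 2)⁻¹ * (1 + u⁻¹)⁻¹) (F := fun u => u⁻¹)
    (fun u hu => by positivity) (fun u hu => le_of_eq ?_) hy.1 M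
  field_simp
  ring

lemma mass_gauss_iterate_le (j : ℕ) {A : Set ℝ} (hA : MeasurableSet A) :
    mass (fun x => (1 + x)⁻¹) (gaussMap^[j] ⁻¹' A) ≤ mass (fun x => (1 + x)⁻¹) A := by
  induction j with
  | zero => simp
  | succ j ih =>
    rw [Function.iterate_succ, preimage_comp]
    exact (mass_gauss_preimage_le (measurable_gaussMap.iterate j hA)).trans ih

lemma mass_one_preimage_le {A : Set ℝ} (hA : MeasurableSet A) :
    mass (fun _ => 1) (gaussMap ⁻¹' A) ≤ mass (fun x => 5 / 3 * (1 + x)⁻¹) A := by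
  refine mass_preimage_le (by fun_prop) (fun z hz => by positivity) (fun y hy M => ?_) hA
  refine (sum_le_of_telescope (t := fun u => (u ^ 2)⁻¹ * 1)
    (F := fun u => u⁻¹ + 1 / (2 * u ^ 2) + 1 / (6 * u ^ 3))
    (fun u hu => by positivity) (fun u hu => ?_) hy.1 M).trans ?_
  · rw [← sub_nonneg]
    have : u⁻¹ + 1 / (2 * u ^ 2) + 1 / (6 * u ^ 3) - ((u + 1)⁻¹ + 1 / (2 * (u + 1) ^ 2) +
        1 / (6 * (u + 1) ^ 3)) - (u ^ 2)⁻¹ * 1 = 1 / (6 * u ^ 3 * (u + 1) ^ 3) := by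
      field_simp
      ring
    rw [this]; positivity
  · have h1 : 0 < 1 + y := by linarith [hy.1]
    rw [← sub_nonneg]
    have : 5 / 3 * (1 + y)⁻¹ - ((1 + y)⁻¹ + 1 / (2 * (1 + y) ^ 2) + 1 / (6 * (1 + y) ^ 3)) =
        (4 * (1 + y) ^ 2 - 3 * (1 + y) - 1) / (6 * (1 + y) ^ 3) := by
      field_simp
      ring
    rw [this]
    exact div_nonneg (by nlinarith [hy.1]) (by positivity)

lemma mass_one_branch_preimage_le {A : Set ℝ} (hA : MeasurableSet A) :
    mass (fun x => ((1 + x) * (2 + x))⁻¹) (gaussMap ⁻¹' A) ≤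
      mass (fun x => 4 / 9 * (1 + x)⁻¹) A := by
  refine mass_preimage_le (by fun_prop) (fun z hz => by positivity) (fun y hy M => ?_) hA
  refine (sum_le_of_telescope (t := fun u => (u ^ 2)⁻¹ * ((1 + u⁻¹) * (2 + u⁻¹))⁻¹)
    (F := fun u => 2 / (4 * u + 1))
    (fun u hu => by positivity) (fun u hu => ?_) hy.1 M).trans ?_
  · have h1 : (u ^ 2)⁻¹ * ((1 + u⁻¹) * (2 + u⁻¹))⁻¹ = 1 / ((u + 1) * (2 * u + 1)) := by
      field_simp
    have h2 : 2 / (4 * u + 1) - 2 / (4 * (u + 1) + 1) = 8 / ((4 * u + 1) * (4 * u + 5)) := by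
      field_simp
      ring
    simp only [h1, h2]
    rw [div_le_div_iff₀ (by positivity) (by positivity)]
    nlinarith
  · have h1 : 0 < 1 + y := by linarith [hy.1]
    rw [← div_eq_mul_inv, div_le_div_iff₀ (by positivity) h1]
    linarith [hy.2]

lemma mass_gauss_sampled_le {k : ℕ} (hk : 2 ≤ k) {a : ℕ} (ha : 1 ≤ a) (v : List ℕ) :
    mass (fun x => (1 + x)⁻¹) (sampledCylinder k (a :: 1 :: v)) ≤
      ENNReal.ofReal (20 / (27 * (a * (a + 1)))) *
        mass (fun x => (1 + x)⁻¹) (sampledCylinder k v) := by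
  obtain ⟨j, rfl⟩ : ∃ j, k = j + 1 + 1 := ⟨k - 2, by omega⟩
  have ha' : (1:ℝ) ≤ a := by exact_mod_cast ha
  have hv := measurableSet_sampledCylinder (j + 1 + 1) v
  have hv1 := measurableSet_sampledCylinder (j + 1 + 1) (1 :: v)
  have hiter : ∀ (i : ℕ) (B : Set ℝ), gaussMap^[i + 1] ⁻¹' B = gaussMap ⁻¹' (gaussMap^[i] ⁻¹' B) :=
    fun i B => by rw [Function.iterate_succ, preimage_comp]
  have hmeas : ∀ (i : ℕ) {B : Set ℝ}, MeasurableSet B → MeasurableSet (gaussMap^[i] ⁻¹' B) :=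
    fun i B hB => measurable_gaussMap.iterate i hB
  have step1 : mass (fun x => (1 + x)⁻¹) (sampledCylinder (j + 1 + 1) (a :: 1 :: v)) ≤
      ENNReal.ofReal (1 / (a * (a + 1))) *
        mass (fun _ => 1) (gaussMap^[j + 1] ⁻¹' sampledCylinder (j + 1 + 1) (1 :: v)) := by
    rw [sampledCylinder_cons, hiter, mass_branch _ ha (hmeas _ hv1),
      ← mass_const_mul (by positivity)]
    refine mass_mono (hmeas _ hv1) fun y hy _ => ?_
    have h0 := hy.1
    have : (((a:ℝ) + y) ^ 2)⁻¹ * (1 + ((a:ℝ) + y)⁻¹)⁻¹ = 1 / ((a + y) * (a + y + 1)) := by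
      field_simp
    rw [this, mul_one]
    gcongr <;> linarith
  have step2 : mass (fun _ => 1) (gaussMap^[j + 1] ⁻¹' sampledCylinder (j + 1 + 1) (1 :: v)) ≤
      ENNReal.ofReal (5 / 3) *
        mass (fun x => (1 + x)⁻¹) (sampledCylinder (j + 1 + 1) (1 :: v)) := by
    rw [hiter]
    refine (mass_one_preimage_le (hmeas _ hv1)).trans ?_
    rw [mass_const_mul (by norm_num)]
    gcongr
    exact mass_gauss_iterate_le j hv1
  have step3 : mass (fun x => (1 + x)⁻¹) (sampledCylinder (j + 1 + 1) (1 :: v)) ≤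
      ENNReal.ofReal (4 / 9) *
        mass (fun x => (1 + x)⁻¹) (sampledCylinder (j + 1 + 1) v) := by
    rw [sampledCylinder_cons, hiter, mass_branch _ le_rfl (hmeas _ hv)]
    calc _ ≤ mass (fun x => ((1 + x) * (2 + x))⁻¹)
          (gaussMap^[j + 1] ⁻¹' sampledCylinder (j + 1 + 1) v) := by
          refine mass_mono (hmeas _ hv) fun y hy _ => le_of_eq ?_
          have h0 := hy.1
          push_cast
          field_simp
          ring
      _ ≤ _ := by
          rw [hiter]
          refine (mass_one_branch_preimage_le (hmeas _ hv)).trans ?_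
          rw [mass_const_mul (by norm_num)]
          gcongr
          exact mass_gauss_iterate_le j hv
  calc _ ≤ _ := step1
    _ ≤ ENNReal.ofReal (1 / (a * (a + 1))) * (ENNReal.ofReal (5 / 3) * (ENNReal.ofReal (4 / 9) *
        mass (fun x => (1 + x)⁻¹) (sampledCylinder (j + 1 + 1) v))) := by
        gcongr
        exact step2.trans (by gcongr)
    _ = _ := by
        rw [← mul_assoc, ← mul_assoc, ← ENNReal.ofReal_mul (by positivity),
          ← ENNReal.ofReal_mul (by positivity)]
        congr 2
        field_simp
        norm_num

lemma mass_one_cons_cons {a : ℕ} (ha : 1 ≤ a) (v : List ℕ) :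
    mass (fun _ => 1) (sampledCylinder 1 (a :: 1 :: v)) =
      mass (fun z => ((a * (1 + z) + 1) ^ 2)⁻¹) (sampledCylinder 1 v) := by
  have hv := measurableSet_sampledCylinder 1 v
  have hv1 := measurableSet_sampledCylinder 1 (1 :: v)
  rw [sampledCylinder_cons, Function.iterate_one, mass_branch _ ha hv1, sampledCylinder_cons,
    Function.iterate_one, mass_branch _ le_rfl hv]
  refine setLIntegral_congr_fun (measurableSet_Ioo.inter hv) fun z hz => ?_
  have h0 := hz.1.1
  simp only [Nat.cast_one]
  congr 1
  field_simp

/-- The word `a, 1, a, 1, …, a, 1` of length `2 * n`. -/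
def altWord (a : ℕ) : ℕ → List ℕ
  | 0 => []
  | n + 1 => a :: 1 :: altWord a n

lemma mass_gauss_altWord_le {k : ℕ} (hk : 2 ≤ k) {a : ℕ} (ha : 1 ≤ a) (n : ℕ) :
    mass (fun x => (1 + x)⁻¹) (sampledCylinder k (altWord a n)) ≤
      ENNReal.ofReal (20 / (27 * (a * (a + 1)))) ^ n := by
  induction n with
  | zero =>
    calc _ ≤ mass (fun _ => 1) (sampledCylinder k (altWord a 0)) :=
          mass_mono (measurableSet_sampledCylinder _ _) fun x hx _ =>
            inv_le_one_of_one_le₀ (by linarith [hx.1])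
      _ ≤ mass (fun _ => 1) univ := lintegral_mono_set (inter_subset_inter_right _ (subset_univ _))
      _ ≤ _ := by simp [mass]
  | succ n ih =>
    rw [pow_succ']
    exact (mass_gauss_sampled_le hk ha _).trans (by gcongr)

lemma le_mass_one_altWord {a : ℕ} (ha : 1 ≤ a) (n : ℕ) :
    ENNReal.ofReal (1 / (2 * a + 1) ^ 2 * (1 / (a + 2) ^ 2) ^ n) ≤
      mass (fun _ => 1) (sampledCylinder 1 (altWord a (n + 1))) := by
  have ha' : (1:ℝ) ≤ a := by exact_mod_cast ha
  induction n with
  | zero =>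
    rw [altWord, mass_one_cons_cons ha]
    calc _ = mass (fun _ => 1 / (2 * (a:ℝ) + 1) ^ 2) (sampledCylinder 1 (altWord a 0)) := by
          simp [mass, altWord, sampledCylinder]
      _ ≤ _ := mass_mono (measurableSet_sampledCylinder _ _) fun z hz _ => by
          have h0 := hz.1
          rw [one_div]
          have : (a:ℝ) * z ≤ a * 1 := by gcongr; exact hz.2.le
          refine inv_anti₀ (by positivity) (pow_le_pow_left₀ (by positivity) ?_ 2)
          linarith
  | succ n ih =>
    rw [altWord, mass_one_cons_cons ha]
    calc _ = ENNReal.ofReal (1 / (a + 2) ^ 2) *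
            ENNReal.ofReal (1 / (2 * a + 1) ^ 2 * (1 / (a + 2) ^ 2) ^ n) := by
          rw [← ENNReal.ofReal_mul (by positivity)]
          congr 1
          ring
      _ ≤ ENNReal.ofReal (1 / (a + 2) ^ 2) *
            mass (fun _ => 1) (sampledCylinder 1 (altWord a (n + 1))) := by gcongr
      _ = mass (fun _ => 1 / ((a:ℝ) + 2) ^ 2 * 1) (sampledCylinder 1 (altWord a (n + 1))) :=
          (mass_const_mul (by positivity) _ _).symm
      _ ≤ _ := mass_mono (measurableSet_sampledCylinder _ _) fun z hz hzv => by
          have h0 := hz.1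
          have hz0 : cfDigit z 0 = a := by
            simpa [altWord] using hzv 0 (by simp [altWord])
          have h := natCast_add_gaussMap h0
          have hT : 0 ≤ gaussMap z := Int.fract_nonneg _
          have haz : a * z ≤ 1 := by
            have : (a:ℝ) ≤ z⁻¹ := by rw [← hz0]; linarith
            calc a * z ≤ z⁻¹ * z := by gcongr
              _ = 1 := inv_mul_cancel₀ h0.ne'
          rw [mul_one, one_div]
          refine inv_anti₀ (by positivity) (pow_le_pow_left₀ (by positivity) ?_ 2)
          linarith

lemma gaussMeasure_apply {A : Set ℝ} (hA : MeasurableSet A) :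
    gaussMeasure A = ENNReal.ofReal (1 / Real.log 2) * mass (fun x => (1 + x)⁻¹) A := by
  have hlog : 0 < Real.log 2 := Real.log_pos (by norm_num)
  rw [gaussMeasure, withDensity_apply _ hA, Measure.restrict_restrict hA, inter_comm,
    ← mass_const_mul (by positivity), mass]
  simp only [one_div, mul_inv, mul_comm]

lemma gaussMeasure_inter_Ioo {A : Set ℝ} (hA : MeasurableSet A) :
    gaussMeasure (Ioo 0 1 ∩ A) = gaussMeasure A := by
  rw [gaussMeasure_apply hA, gaussMeasure_apply (measurableSet_Ioo.inter hA), mass, mass,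
    ← inter_assoc, inter_self]

lemma gaussMeasure_univ : gaussMeasure univ = 1 := by
  have hlog : 0 < Real.log 2 := Real.log_pos (by norm_num)
  have hint : ∫ x in (0:ℝ)..1, (1 + x)⁻¹ = Real.log 2 := by
    rw [intervalIntegral.integral_comp_add_left (fun x => x⁻¹) 1,
      integral_inv_of_pos (by norm_num) (by norm_num)]
    norm_num
  have hI : IntervalIntegrable (fun x : ℝ => (1 + x)⁻¹) volume 0 1 := by
    by_contra h
    rw [intervalIntegral.integral_undef h] at hint
    exact hlog.ne hint
  rw [gaussMeasure_apply .univ, mass, inter_univ, setLIntegral_congr Ioo_ae_eq_Ioc,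
    ← ofReal_integral_eq_lintegral_ofReal, ← intervalIntegral.integral_of_le zero_le_one, hint,
    ← ENNReal.ofReal_mul (by positivity), one_div_mul_cancel hlog.ne', ENNReal.ofReal_one]
  · exact (intervalIntegrable_iff_integrableOn_Ioc_of_le zero_le_one).1 hI
  · filter_upwards [ae_restrict_mem measurableSet_Ioc] with x hx
    have := hx.1
    simp only [Pi.zero_apply]
    positivity

instance : IsProbabilityMeasure gaussMeasure := ⟨gaussMeasure_univ⟩

lemma ae_gaussMeasure_irrational : ∀ᵐ z ∂gaussMeasure, Irrational z ∧ z ∈ Ioo (0:ℝ) 1 := by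
  refine (withDensity_absolutelyContinuous _ _).ae_le ?_
  filter_upwards [ae_restrict_mem measurableSet_Ioo, ae_restrict_of_ae
    (show ∀ᵐ z : ℝ, z ∉ range ((↑) : ℚ → ℝ) from (countable_range _).ae_notMem _)] with z h1 h2
  exact ⟨h2, h1⟩

lemma gaussMap_irrational {z : ℝ} (hz : Irrational z) :
    Irrational (gaussMap z) ∧ gaussMap z ∈ Ioo (0:ℝ) 1 := by
  have h : Irrational (gaussMap z) := by
    rw [gaussMap, ← Int.self_sub_floor]
    exact (irrational_inv_iff.2 hz).sub_intCast _
  exact ⟨h, lt_of_le_of_ne (Int.fract_nonneg _) h.ne_zero.symm, Int.fract_lt_one _⟩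

lemma cfDigit_pos {z : ℝ} (hz : Irrational z) (h01 : z ∈ Ioo (0:ℝ) 1) (i : ℕ) :
    0 < cfDigit z i := by
  have : Irrational (gaussMap^[i] z) ∧ gaussMap^[i] z ∈ Ioo (0:ℝ) 1 := by
    induction i with
    | zero => exact ⟨hz, h01⟩
    | succ i ih =>
      rw [Function.iterate_succ_apply']
      exact gaussMap_irrational ih.1
  rw [cfDigit, Nat.floor_pos]
  exact one_le_inv₀ this.2.1 |>.2 this.2.2.le

/-- The positive words whose letters at the places `0, k, 2k, …` do not spell `w`. -/
def MismatchedWord (k : ℕ) (w : List ℕ) : Type :=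
  {v : List ℕ // v.length = w.length * k ∧ (∀ a ∈ v, 0 < a) ∧
    ∃ j < w.length, v.getD (j * k) 0 ≠ w.getD j 0}

instance (k : ℕ) (w : List ℕ) : Countable (MismatchedWord k w) :=
  inferInstanceAs (Countable (Subtype _))

lemma one_le_gaussMeasure_add_tsum {k : ℕ} (hk : 1 ≤ k) (w : List ℕ) :
    1 ≤ gaussMeasure (sampledCylinder k w) +
      ∑' v : MismatchedWord k w, gaussMeasure (cylinder v.1) := by
  rw [← gaussMeasure_univ]
  refine le_trans ?_ ((measure_union_le _ _).trans
    (add_le_add_right (measure_iUnion_le _) _))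
  refine measure_mono_ae ?_
  filter_upwards [ae_gaussMeasure_irrational] with z hz _
  by_cases hzw : z ∈ sampledCylinder k w
  · exact Or.inl hzw
  right
  have hzw' : ∃ j < w.length, cfDigit z (j * k) ≠ w.getD j 0 := by
    simpa [sampledCylinder] using hzw
  obtain ⟨j, hj, hne⟩ := hzw'
  let v := List.ofFn fun i : Fin (w.length * k) => cfDigit z i
  have hv : ∀ i < w.length * k, v.getD i 0 = cfDigit z i := fun i hi => by
    simp [v, List.getD, hi]
  have hvl : v.length = w.length * k := List.length_ofFn
  refine mem_iUnion.2 ⟨⟨v, hvl, ?_, j, hj, ?_⟩, hz.2, ?_⟩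
  · intro a ha
    obtain ⟨i, rfl⟩ := (List.mem_ofFn' _ _).1 ha
    exact cfDigit_pos hz.1 hz.2 _
  · rwa [hv _ (Nat.mul_lt_mul_of_pos_right hj hk)]
  · intro i hi
    exact (hv i (hvl ▸ hi)).symm

open Classical in
lemma blockCount_eq (x : ℝ) (s : List ℕ) (N : ℕ) :
    blockCount x 1 s N =
      ((Finset.range (N + 1)).filter fun i => gaussMap^[i] x ∈ cylinder s).card := by
  refine Nat.subtype_card _ fun i => ?_
  simp

lemma iterate_mem_cylinder_getD {x : ℝ} {i : ℕ} {s : List ℕ} (h : gaussMap^[i] x ∈ cylinder s)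
    {j : ℕ} (hj : j < s.length) : s.getD j 0 = cfDigit x (i + j) := by
  rw [← cfDigit_iterate, h.2 j hj]

lemma blockCount_add_sum_le {x y : ℝ} {k b : ℕ} (hk : 1 ≤ k) (hb : 1 ≤ b)
    (hdig : ∀ i : ℕ, cfDigit y i = cfDigit x (b - 1 + i * k)) (w : List ℕ)
    (F : Finset (MismatchedWord k w)) (N : ℕ) :
    blockCount y 1 w N + ∑ v ∈ F, blockCount x 1 v.1 (k * N + (b - 1)) ≤ k * N + b := by
  classical
  let S : MismatchedWord k w → Finset ℕ := fun v =>
    (Finset.range (k * N + (b - 1) + 1)).filter fun i => gaussMap^[i] x ∈ cylinder v.1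
  let R : Finset ℕ :=
    ((Finset.range (N + 1)).filter fun i => gaussMap^[i] y ∈ cylinder w).image
      fun i => b - 1 + i * k
  have hR : R.card = blockCount y 1 w N := by
    rw [blockCount_eq]
    refine Finset.card_image_of_injective _ fun i j hij => ?_
    exact Nat.eq_of_mul_eq_mul_right (by omega) (Nat.add_left_cancel hij)
  have hS : (F.biUnion S).card = ∑ v ∈ F, blockCount x 1 v.1 (k * N + (b - 1)) := by
    simp only [blockCount_eq]
    refine Finset.card_biUnion fun u _ v _ huv => ?_
    refine Finset.disjoint_left.2 fun i hi hi' => huv (Subtype.ext ?_)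
    have hu := (Finset.mem_filter.1 hi).2
    have hv := (Finset.mem_filter.1 hi').2
    refine List.ext_getElem (u.2.1.trans v.2.1.symm) fun j h1 h2 => ?_
    have e1 := iterate_mem_cylinder_getD hu h1
    have e2 := iterate_mem_cylinder_getD hv h2
    rw [List.getD_eq_getElem _ _ h1] at e1
    rw [List.getD_eq_getElem _ _ h2] at e2
    rw [e1, e2]
  have hdisj : Disjoint R (F.biUnion S) := by
    refine Finset.disjoint_left.2 fun i hi hi' => ?_
    obtain ⟨l, hl, rfl⟩ := Finset.mem_image.1 hi
    obtain ⟨v, -, hv⟩ := Finset.mem_biUnion.1 hi'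
    obtain ⟨j, hj, hne⟩ := v.2.2.2
    refine hne ?_
    rw [iterate_mem_cylinder_getD (Finset.mem_filter.1 hl).2 hj,
      iterate_mem_cylinder_getD (Finset.mem_filter.1 hv).2
        (by rw [v.2.1]; exact Nat.mul_lt_mul_of_pos_right hj hk), hdig]
    congr 1
    ring
  rw [← hR, ← hS, ← Finset.card_union_of_disjoint hdisj]
  have hsub : R ∪ F.biUnion S ⊆ Finset.range (k * N + b) := by
    refine Finset.union_subset (fun i hi => ?_) (fun i hi => ?_)
    · obtain ⟨l, hl, rfl⟩ := Finset.mem_image.1 hi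
      have h := Finset.mem_range.1 (Finset.mem_filter.1 hl).1
      have : l * k ≤ k * N := by rw [mul_comm]; exact Nat.mul_le_mul_left _ (by omega)
      exact Finset.mem_range.2 (by omega)
    · obtain ⟨v, -, hv⟩ := Finset.mem_biUnion.1 hi
      have h := Finset.mem_range.1 (Finset.mem_filter.1 hv).1
      exact Finset.mem_range.2 (by omega)
  simpa using Finset.card_le_card hsub

lemma tendsto_mul_add_div (k c : ℕ) :
    Tendsto (fun N : ℕ => ((k * N + c : ℕ) : ℝ) / N) atTop (nhds k) := by
  have h : Tendsto (fun N : ℕ => (k : ℝ) + c / N) atTop (nhds (k + 0)) :=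
    tendsto_const_nhds.add (tendsto_const_div_atTop_nhds_zero_nat _)
  rw [add_zero] at h
  refine h.congr' ?_
  filter_upwards [eventually_gt_atTop 0] with N hN
  have : (N:ℝ) ≠ 0 := by positivity
  push_cast
  field_simp

lemma gaussMeasure_cylinder_le {x y : ℝ} (hx : CFNormal x) (hy : CFNormal y) {k b : ℕ}
    (hk : 1 ≤ k) (hb : 1 ≤ b) (hdig : ∀ i : ℕ, cfDigit y i = cfDigit x (b - 1 + i * k))
    {w : List ℕ} (hw : w ≠ []) (hpos : ∀ a ∈ w, 0 < a) :
    gaussMeasure (cylinder w) ≤ k * gaussMeasure (sampledCylinder k w) := by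
  have hfin : ∀ F : Finset (MismatchedWord k w),
      gaussMeasure (cylinder w) + k * ∑ v ∈ F, gaussMeasure (cylinder v.1) ≤ k := by
    intro F
    have hF : Tendsto (fun N : ℕ => ∑ v ∈ F,
        (blockCount x 1 v.1 (k * N + (b - 1)) : ℝ) / (k * N + (b - 1) : ℕ) *
          ((k * N + (b - 1) : ℕ) / N)) atTop
        (nhds (∑ v ∈ F, (gaussMeasure (cylinder v.1)).toReal * k)) := by
      refine tendsto_finsetSum _ fun v _ => Tendsto.mul ?_ (tendsto_mul_add_div _ _)
      have hv : v.1 ≠ [] := by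
        intro h
        have := v.2.1
        rw [h, List.length_nil, eq_comm, mul_eq_zero, List.length_eq_zero_iff] at this
        rcases this with h | h
        · exact hw h
        · omega
      refine (hx v.1 hv v.2.2.1).comp (tendsto_atTop_mono (fun N => ?_) tendsto_id)
      exact (Nat.le_mul_of_pos_left N hk).trans (Nat.le_add_right _ _)
    have hlim := le_of_tendsto_of_tendsto ((hy w hw hpos).add hF) (tendsto_mul_add_div k b) (by
      filter_upwards [eventually_gt_atTop 0] with N hN
      have hN' : (0:ℝ) < N := by positivity
      have hkN : ((k * N + (b - 1) : ℕ) : ℝ) ≠ 0 := by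
        have := Nat.mul_pos hk hN
        exact_mod_cast (by omega : k * N + (b - 1) ≠ 0)
      have h : (blockCount y 1 w N : ℝ) + ∑ v ∈ F, (blockCount x 1 v.1 (k * N + (b - 1)) : ℝ) ≤
          (k * N + b : ℕ) := by exact_mod_cast blockCount_add_sum_le hk hb hdig w F N
      simp only [div_mul_div_cancel₀ hkN]
      rw [← Finset.sum_div, ← add_div]
      gcongr)
    have hsum : (k:ENNReal) * ∑ v ∈ F, gaussMeasure (cylinder v.1) ≠ ⊤ :=
      ENNReal.mul_ne_top (ENNReal.natCast_ne_top k)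
        (ENNReal.sum_ne_top.2 fun _ _ => measure_ne_top _ _)
    rw [← ENNReal.toReal_le_toReal (ENNReal.add_ne_top.2 ⟨measure_ne_top _ _, hsum⟩)
      (ENNReal.natCast_ne_top k), ENNReal.toReal_add (measure_ne_top _ _) hsum, ENNReal.toReal_mul,
      ENNReal.toReal_sum (fun _ _ => measure_ne_top _ _), ENNReal.toReal_natCast, mul_comm,
      Finset.sum_mul]
    exact hlim
  set B := ∑' v : MismatchedWord k w, gaussMeasure (cylinder v.1)
  have hB : gaussMeasure (cylinder w) + k * B ≤ k := by
    simp only [B, ENNReal.tsum_eq_iSup_sum, ENNReal.mul_iSup, ENNReal.add_iSup]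
    exact iSup_le hfin
  have hkB : (k:ENNReal) * B ≠ ⊤ :=
    ((le_add_self.trans hB).trans_lt (ENNReal.natCast_lt_top k)).ne
  refine (ENNReal.add_le_add_iff_right hkB).1 (hB.trans ?_)
  rw [← mul_add]
  exact le_mul_of_one_le_right (by simp) (one_le_gaussMeasure_add_tsum hk w)

theorem ap_subsequence_not_normal (x : ℝ) (hx : x ∈ Set.Ioo (0:ℝ) 1)
    (hnorm : CFNormal x) (k b : ℕ) (hk : 2 ≤ k) (hb : 1 ≤ b)
    (y : ℝ) (hy : y ∈ Set.Ioo (0:ℝ) 1)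
    (hdig : ∀ i : ℕ, cfDigit y i = cfDigit x (b - 1 + i * k)) :
    ¬ CFNormal y := by
  intro hynorm
  have hlog : 0 < Real.log 2 := Real.log_pos (by norm_num)
  have hposw : ∀ n, ∀ a ∈ altWord 20 n, 0 < a := by
    intro n
    induction n with
    | zero => simp [altWord]
    | succ n ih => simpa [altWord] using ih
  have hmass : ∀ n, mass (fun z => (1 + z)⁻¹) (sampledCylinder 1 (altWord 20 (n + 1))) ≤
      k * mass (fun z => (1 + z)⁻¹) (sampledCylinder k (altWord 20 (n + 1))) := by
    intro n
    have h := gaussMeasure_cylinder_le hnorm hynorm (by omega) hb hdig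
      (w := altWord 20 (n + 1)) (by simp [altWord]) (hposw _)
    rw [cylinder_eq, gaussMeasure_inter_Ioo (measurableSet_sampledCylinder _ _),
      gaussMeasure_apply (measurableSet_sampledCylinder _ _),
      gaussMeasure_apply (measurableSet_sampledCylinder _ _), mul_left_comm] at h
    exact (ENNReal.mul_le_mul_iff_right (by simpa using hlog) ENNReal.ofReal_ne_top).1 h
  have hreal : ∀ n : ℕ, 1 / 2 * (1 / 41 ^ 2 * (1 / 22 ^ 2) ^ n) ≤
      (k:ℝ) * (1 / 567) ^ (n + 1) := by
    intro n
    rw [← ENNReal.ofReal_le_ofReal_iff (by positivity)]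
    calc ENNReal.ofReal (1 / 2 * (1 / 41 ^ 2 * (1 / 22 ^ 2) ^ n))
        ≤ ENNReal.ofReal (1 / 2) *
            mass (fun _ => 1) (sampledCylinder 1 (altWord 20 (n + 1))) := by
          rw [ENNReal.ofReal_mul (by positivity)]
          gcongr
          refine le_trans (le_of_eq ?_) (le_mass_one_altWord (by norm_num) n)
          norm_num
      _ ≤ mass (fun z => (1 + z)⁻¹) (sampledCylinder 1 (altWord 20 (n + 1))) := by
          rw [← mass_const_mul (by norm_num)]
          refine mass_mono (measurableSet_sampledCylinder _ _) fun z hz _ => ?_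
          have := hz.1
          rw [mul_one, one_div]
          gcongr
          linarith [hz.2]
      _ ≤ k * ENNReal.ofReal (1 / 567) ^ (n + 1) := by
          refine (hmass n).trans ?_
          gcongr
          refine (mass_gauss_altWord_le hk (by norm_num) _).trans (le_of_eq ?_)
          norm_num
      _ = _ := by
          rw [ENNReal.ofReal_mul (by positivity), ENNReal.ofReal_pow (by positivity),
            ENNReal.ofReal_natCast]
  have hlim : Tendsto (fun n : ℕ => (k:ℝ) / 567 * (484 / 567) ^ n) atTop (nhds 0) := by
    simpa using (tendsto_pow_atTop_nhds_zero_of_lt_one (by norm_num : (0:ℝ) ≤ 484 / 567)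
      (by norm_num)).const_mul ((k:ℝ) / 567)
  have hge : ∀ n : ℕ, (1 / 3362 : ℝ) ≤ (k:ℝ) / 567 * (484 / 567) ^ n := by
    intro n
    have h := mul_le_mul_of_nonneg_right (hreal n) (by positivity : (0:ℝ) ≤ 484 ^ n)
    calc (1 / 3362 : ℝ) = 1 / 2 * (1 / 41 ^ 2 * (1 / 22 ^ 2) ^ n) * 484 ^ n := by
          rw [mul_assoc, mul_assoc, ← mul_pow]; norm_num
      _ ≤ _ := h
      _ = _ := by rw [div_pow, div_pow, one_pow, pow_succ]; field_simp
  have := ge_of_tendsto' hlim hge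
  norm_num at this
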